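/- Let A = (a_1, …, a_r) be a tuple of positive integers with r ≥ 3, and let L_A be the quotient of the free abelian group on generators x_1, …, x_r by the subgroup generated by a_i x_i − a_j x_j for all i, j, with canonical element c := a_1 x_1 = … = a_r x_r, partially ordered by x ≤ y iff the normal form of y − x has nonnegative coefficient of c. Then the interval {x ∈ L_A : 0 ≤ x ≤ c} consists exactly of the elements 0, c, and j·x_i for 1 ≤ i ≤ r and 1 ≤ j ≤ a_i − 1, these elements are pairwise distinct, and hence the interval has cardinality 2 + Σ_{i=1}^r (a_i − 1). -/

import Mathlib

/-- The subgroup of relations `a_i x_i − a_j x_j` in the free abelian group on `r` letters. -/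
noncomputable def orbRels (r : ℕ) (a : Fin r → ℕ) : AddSubgroup (Fin r →₀ ℤ) :=
  AddSubgroup.closure
    {z | ∃ i j : Fin r, z = (a i : ℤ) • Finsupp.single i 1 - (a j : ℤ) • Finsupp.single j 1}

/-- The group `L_A`: the free abelian group on `x_1, …, x_r` modulo `a_i x_i = a_j x_j`. -/
abbrev LGroup (r : ℕ) (a : Fin r → ℕ) : Type := (Fin r →₀ ℤ) ⧸ orbRels r a

/-- The image of the generator `x_i` in `L_A`. -/
noncomputable def LGen (r : ℕ) (a : Fin r → ℕ) (i : Fin r) : LGroup r a :=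
  QuotientAddGroup.mk (Finsupp.single i 1)

/-- `x ≥ 0` in `L_A`: the coefficient of `c` in the normal form of `x` is nonnegative. -/
def LNonneg (r : ℕ) (a : Fin r → ℕ) (c : LGroup r a) (x : LGroup r a) : Prop :=
  ∃ l : ℤ, ∃ li : Fin r → ℕ, 0 ≤ l ∧ (∀ i, li i < a i) ∧
    x = l • c + ∑ i, (li i) • LGen r a i

theorem exists_mul_of_mem_orbRels {r : ℕ} {a : Fin r → ℕ} {z : Fin r →₀ ℤ}
    (hz : z ∈ orbRels r a) :
    ∃ k : Fin r → ℤ, (∀ i, z i = a i * k i) ∧ ∑ i, k i = 0 := by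
  induction hz using AddSubgroup.closure_induction with
  | mem z hz =>
    obtain ⟨i, j, rfl⟩ := hz
    refine ⟨Pi.single i 1 - Pi.single j 1, fun t => ?_, ?_⟩
    · by_cases hi : t = i <;> by_cases hj : t = j <;>
        simp [Pi.single_apply, Finsupp.single_apply, hi, hj, eq_comm] <;> grind
    · simp [Finset.sum_sub_distrib]
  | zero => exact ⟨0, by simp, by simp⟩
  | add x y _ _ hx hy =>
    obtain ⟨k, hk, hk0⟩ := hx
    obtain ⟨m, hm, hm0⟩ := hy
    exact ⟨k + m, fun i => by simp [hk, hm, mul_add],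
      by simp [Finset.sum_add_distrib, hk0, hm0]⟩
  | neg x _ hx =>
    obtain ⟨k, hk, hk0⟩ := hx
    exact ⟨-k, fun i => by simp [hk], by simp [hk0]⟩

theorem exists_mul_of_sum_zsmul_eq_zero {r : ℕ} {a : Fin r → ℕ} {n : Fin r → ℤ}
    (h : ∑ i, n i • LGen r a i = 0) :
    ∃ k : Fin r → ℤ, (∀ i, n i = a i * k i) ∧ ∑ i, k i = 0 := by
  have hmk : ∑ i, n i • LGen r a i
      = ((∑ i, n i • Finsupp.single i (1 : ℤ) : Fin r →₀ ℤ) : LGroup r a) := by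
    change _ = QuotientAddGroup.mk' (orbRels r a) _
    rw [map_sum]
    rfl
  rw [hmk, QuotientAddGroup.eq_zero_iff] at h
  obtain ⟨k, hk, hk0⟩ := exists_mul_of_mem_orbRels h
  refine ⟨k, fun i => ?_, hk0⟩
  rw [← hk i]
  simp [Finsupp.finsetSum_apply, Finsupp.single_apply]

/-- A relation `l c + ∑ n_i x_i = 0` in `L_A` forces `n_i = a_i k_i` with `l + ∑ k_i = 0`. -/
theorem exists_mul_of_canonical_relation {r : ℕ} {a : Fin r → ℕ}
    {c : LGroup r a} (hc : ∀ i, c = a i • LGen r a i) (i₀ : Fin r) {l : ℤ} {n : Fin r → ℤ}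
    (h : l • c + ∑ i, n i • LGen r a i = 0) :
    ∃ k : Fin r → ℤ, (∀ i, n i = a i * k i) ∧ l + ∑ i, k i = 0 := by
  have h' : ∑ i, (n i + Pi.single (M := fun _ => ℤ) i₀ (l * a i₀) i) • LGen r a i = 0 := by
    rw [← h, hc i₀]
    simp only [add_zsmul, Finset.sum_add_distrib, Pi.single_apply, ite_smul, zero_zsmul,
      Finset.sum_ite_eq', Finset.mem_univ, if_true]
    rw [add_comm, mul_smul, natCast_zsmul]
  obtain ⟨k, hk, hk0⟩ := exists_mul_of_sum_zsmul_eq_zero h'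
  refine ⟨k - Pi.single i₀ l, fun i => ?_, by simp [hk0]⟩
  have := hk i
  by_cases hi : i = i₀
  · subst hi
    simp at this ⊢
    linarith
  · simpa [Pi.single_apply, hi] using this

theorem natCast_ne_mul_of_le_pred {a j : ℕ} (h1 : 1 ≤ j) (h2 : j ≤ a - 1) (k : ℤ) : (j : ℤ) ≠ a * k := by
  intro h
  have hd : a ∣ j := Int.natCast_dvd_natCast.mp ⟨k, h⟩
  have := Nat.le_of_dvd h1 hd
  omega

theorem sum_single_nsmul_LGen {r : ℕ} {a : Fin r → ℕ} (i : Fin r) (j : ℕ) :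
    ∑ t, (Pi.single i j : Fin r → ℕ) t • LGen r a t = j • LGen r a i := by
  simp [Pi.single_apply, ite_smul]

theorem lNonneg_canonical {r : ℕ} {a : Fin r → ℕ} (ha : ∀ i, 0 < a i) (c : LGroup r a) :
    LNonneg r a c c :=
  ⟨1, 0, by simp, by simpa using ha, by simp⟩

theorem lNonneg_zero {r : ℕ} {a : Fin r → ℕ} (ha : ∀ i, 0 < a i) (c : LGroup r a) :
    LNonneg r a c 0 :=
  ⟨0, 0, by simp, by simpa using ha, by simp⟩

theorem lNonneg_nsmul_LGen {r : ℕ} {a : Fin r → ℕ} (ha : ∀ i, 0 < a i) (c : LGroup r a)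
    {i : Fin r} {j : ℕ} (hj : j < a i) : LNonneg r a c (j • LGen r a i) := by
  refine ⟨0, Pi.single i j, le_rfl, fun t => ?_, by rw [sum_single_nsmul_LGen]; simp⟩
  by_cases ht : t = i
  · subst ht; simpa using hj
  · simpa [Pi.single_apply, ht] using ha t

theorem eq_of_mem_interval {r : ℕ} {a : Fin r → ℕ} (ha : ∀ i, 0 < a i)
    {c : LGroup r a} (hc : ∀ i, c = a i • LGen r a i) (i₀ : Fin r) {x : LGroup r a}
    (hx : LNonneg r a c x) (hcx : LNonneg r a c (c - x)) :
    x = 0 ∨ x = c ∨ ∃ i : Fin r, ∃ j : ℕ, 1 ≤ j ∧ j ≤ a i - 1 ∧ x = j • LGen r a i := by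
  obtain ⟨l, n, hl, hn, rfl⟩ := hx
  obtain ⟨m, p, hm, hp, h⟩ := hcx
  have hrel : (l + m - 1) • c + ∑ i, ((n i : ℤ) + p i) • LGen r a i = 0 := by
    simp only [add_zsmul, sub_zsmul, Finset.sum_add_distrib, natCast_zsmul, one_zsmul]
    rw [sub_eq_iff_eq_add] at h
    nth_rewrite 3 [h]
    abel
  obtain ⟨k, hk, hk1⟩ := exists_mul_of_canonical_relation hc i₀ hrel
  have hk_nonneg : ∀ i, 0 ≤ k i := fun i => by
    have h1 : 0 ≤ (a i : ℤ) * k i := by rw [← hk i]; positivity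
    exact nonneg_of_mul_nonneg_right h1 (by exact_mod_cast ha i)
  have hn_zero : ∀ i, k i = 0 → n i = 0 := fun i hi => by
    have := hk i
    rw [hi] at this
    omega
  have hsum : 0 ≤ ∑ i, k i := Finset.sum_nonneg fun i _ => hk_nonneg i
  by_cases hall : ∀ i, k i = 0
  · have hn0 : ∀ i, n i = 0 := fun i => hn_zero i (hall i)
    have : l = 0 ∨ l = 1 := by simp [hall] at hk1; omega
    rcases this with rfl | rfl
    · left; simp [hn0]
    · right; left; simp [hn0]
  · push Not at hall
    obtain ⟨i, hi⟩ := hall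
    have hsplit := Finset.add_sum_erase Finset.univ k (Finset.mem_univ i)
    have herase : 0 ≤ ∑ t ∈ Finset.univ.erase i, k t :=
      Finset.sum_nonneg fun t _ => hk_nonneg t
    have hi0 := hk_nonneg i
    have hki : k i = 1 := by omega
    have herase0 : ∑ t ∈ Finset.univ.erase i, k t = 0 := by omega
    have hl0 : l = 0 := by omega
    have hn0 : ∀ t, t ≠ i → n t = 0 := fun t ht =>
      hn_zero t ((Finset.sum_eq_zero_iff_of_nonneg fun t _ => hk_nonneg t).mp herase0 t
        (by simp [ht]))
    have hni := hk i
    rw [hki] at hni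
    refine Or.inr (Or.inr ⟨i, n i, ?_, ?_, ?_⟩)
    · have := hp i; omega
    · have := hn i; omega
    · rw [hl0, Finset.sum_eq_single i (fun t _ ht => by simp [hn0 t ht]) (by simp)]
      simp

theorem nsmul_LGen_add_zsmul_canonical_ne_zero {r : ℕ} {a : Fin r → ℕ}
    {c : LGroup r a} (hc : ∀ i, c = a i • LGen r a i) {i : Fin r} {j : ℕ} (h1 : 1 ≤ j)
    (h2 : j ≤ a i - 1) (l : ℤ) : l • c + j • LGen r a i ≠ 0 := by
  intro h
  have h' : l • c + ∑ t, ((Pi.single i j : Fin r → ℕ) t : ℤ) • LGen r a t = 0 := by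
    simpa only [natCast_zsmul, sum_single_nsmul_LGen] using h
  obtain ⟨k, hk, -⟩ := exists_mul_of_canonical_relation hc i h'
  exact natCast_ne_mul_of_le_pred h1 h2 (k i) (by simpa using hk i)

theorem canonical_ne_zero {r : ℕ} {a : Fin r → ℕ} (ha : ∀ i, 0 < a i)
    {c : LGroup r a} (hc : ∀ i, c = a i • LGen r a i) (i₀ : Fin r) : c ≠ 0 := by
  intro h
  have h' : (1 : ℤ) • c + ∑ t, (0 : ℤ) • LGen r a t = 0 := by simpa using h
  obtain ⟨k, hk, hk1⟩ := exists_mul_of_canonical_relation (n := fun _ => 0) hc i₀ h'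
  have hk0 : ∀ i, k i = 0 := fun i => by simpa [(ha i).ne'] using hk i
  simp [hk0] at hk1

theorem nsmul_LGen_inj {r : ℕ} {a : Fin r → ℕ} {i i' : Fin r} {j j' : ℕ}
    (h1 : 1 ≤ j) (h2 : j ≤ a i - 1) (h1' : 1 ≤ j') (h2' : j' ≤ a i' - 1)
    (h : j • LGen r a i = j' • LGen r a i') : i = i' ∧ j = j' := by
  have h' : ∑ t, (((Pi.single i j : Fin r → ℕ) t : ℤ) - (Pi.single i' j' : Fin r → ℕ) t) •
      LGen r a t = 0 := by
    simp only [sub_smul, natCast_zsmul, Finset.sum_sub_distrib, sum_single_nsmul_LGen, h, sub_self]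
  obtain ⟨k, hk, -⟩ := exists_mul_of_sum_zsmul_eq_zero h'
  have hki := hk i
  by_cases hi : i = i'
  · subst hi
    refine ⟨rfl, ?_⟩
    simp only [Pi.single_eq_same] at hki
    have hk0 : (j : ℤ) - j' = 0 := Int.eq_zero_of_abs_lt_dvd ⟨k i, hki⟩ (by rw [abs_lt]; omega)
    omega
  · exact absurd (by simpa [Pi.single_apply, hi] using hki) (natCast_ne_mul_of_le_pred h1 h2 (k i))

/-- the interval `{x ∈ L_A : 0 ≤ x ≤ c}` consists exactly of `0`, `c`,
and `j·x_i` for `1 ≤ i ≤ r`, `1 ≤ j ≤ a_i − 1`; these elements are pairwise distinct,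
so the interval has cardinality `2 + ∑ (a_i − 1)`. -/
theorem interval_zero_canonical (r : ℕ) (hr : 3 ≤ r)
    (a : Fin r → ℕ) (ha : ∀ i, 2 ≤ a i)
    (c : LGroup r a) (hc : ∀ i, c = a i • LGen r a i) :
    (∀ x : LGroup r a,
      (LNonneg r a c x ∧ LNonneg r a c (c - x)) ↔
        (x = 0 ∨ x = c ∨
          ∃ i : Fin r, ∃ j : ℕ, 1 ≤ j ∧ j ≤ a i - 1 ∧ x = j • LGen r a i)) ∧
    ((0 : LGroup r a) ≠ c) ∧
    (∀ i : Fin r, ∀ j : ℕ, 1 ≤ j → j ≤ a i - 1 →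
      j • LGen r a i ≠ 0 ∧ j • LGen r a i ≠ c) ∧
    (∀ i i' : Fin r, ∀ j j' : ℕ, 1 ≤ j → j ≤ a i - 1 → 1 ≤ j' → j' ≤ a i' - 1 →
      j • LGen r a i = j' • LGen r a i' → i = i' ∧ j = j') ∧
    Set.ncard {x : LGroup r a | LNonneg r a c x ∧ LNonneg r a c (c - x)} =
      2 + ∑ i, (a i - 1) := by
  have hpos : ∀ i, 0 < a i := fun i => by have := ha i; omega
  let i₀ : Fin r := ⟨0, by omega⟩
  have hc0 : c ≠ 0 := canonical_ne_zero hpos hc i₀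
  have hne0 : ∀ i : Fin r, ∀ j : ℕ, 1 ≤ j → j ≤ a i - 1 → j • LGen r a i ≠ 0 :=
    fun i j h1 h2 h => nsmul_LGen_add_zsmul_canonical_ne_zero hc h1 h2 0 (by simp [h])
  have hnec : ∀ i : Fin r, ∀ j : ℕ, 1 ≤ j → j ≤ a i - 1 → j • LGen r a i ≠ c :=
    fun i j h1 h2 h => nsmul_LGen_add_zsmul_canonical_ne_zero hc h1 h2 (-1) (by simp [h])
  have hmem : ∀ x : LGroup r a, (LNonneg r a c x ∧ LNonneg r a c (c - x)) ↔
      (x = 0 ∨ x = c ∨ ∃ i : Fin r, ∃ j : ℕ, 1 ≤ j ∧ j ≤ a i - 1 ∧ x = j • LGen r a i) := by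
    refine fun x => ⟨fun h => eq_of_mem_interval hpos hc i₀ h.1 h.2, ?_⟩
    rintro (rfl | rfl | ⟨i, j, h1, h2, rfl⟩)
    · exact ⟨lNonneg_zero hpos c, by simpa using lNonneg_canonical hpos c⟩
    · exact ⟨lNonneg_canonical hpos _, by simpa using lNonneg_zero hpos _⟩
    · refine ⟨lNonneg_nsmul_LGen hpos c (by omega), ?_⟩
      have hsub : c - j • LGen r a i = (a i - j) • LGen r a i := by
        rw [hc i, sub_eq_iff_eq_add, ← add_smul, Nat.sub_add_cancel (by omega)]
      rw [hsub]
      exact lNonneg_nsmul_LGen hpos c (by omega)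
  refine ⟨hmem, hc0.symm, fun i j h1 h2 => ⟨hne0 i j h1 h2, hnec i j h1 h2⟩,
    fun i i' j j' h1 h2 h1' h2' h => nsmul_LGen_inj h1 h2 h1' h2' h, ?_⟩
  let g : (Σ i : Fin r, Fin (a i - 1)) → LGroup r a := fun p => (p.2.val + 1) • LGen r a p.1
  have hg : Function.Injective g := by
    rintro ⟨i, j⟩ ⟨i', j'⟩ h
    obtain ⟨rfl, hj⟩ := nsmul_LGen_inj (by omega) (by omega) (by omega) (by omega) h
    exact congrArg _ (Fin.ext (Nat.succ_injective hj))
  have hset : {x : LGroup r a | LNonneg r a c x ∧ LNonneg r a c (c - x)} =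
      insert 0 (insert c (Set.range g)) := by
    ext x
    simp only [Set.mem_ofPred_eq, hmem, Set.mem_insert_iff, Set.mem_range]
    refine or_congr_right (or_congr_right ⟨?_, ?_⟩)
    · rintro ⟨i, j, h1, h2, rfl⟩
      exact ⟨⟨i, j - 1, by omega⟩, by simp [g, Nat.sub_add_cancel h1]⟩
    · rintro ⟨⟨i, j⟩, rfl⟩
      exact ⟨i, j + 1, by omega, by omega, rfl⟩
  have hcg : c ∉ Set.range g := by
    rintro ⟨⟨i, j⟩, h⟩
    exact hnec i (j + 1) (by omega) (by omega) h
  have h0g : (0 : LGroup r a) ∉ insert c (Set.range g) := by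
    rintro (h | ⟨⟨i, j⟩, h⟩)
    · exact hc0 h.symm
    · exact hne0 i (j + 1) (by omega) (by omega) h
  have hcard : (Set.range g).ncard = ∑ i, (a i - 1) := by
    rw [← Nat.card_coe_set_eq, Nat.card_range_of_injective hg]
    simp
  rw [hset, Set.ncard_insert_of_notMem h0g, Set.ncard_insert_of_notMem hcg, hcard]
  omega
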